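/- Fix b₀ > 0, θ₀ = arctan b₀, δ, δ₀, α ∈ (0, 1), and L ≥ 4. Let Q = {y ∈ ℝ³ : y₁ > 0, y₃ > b₀y₁} and Q_L = Q ∩ {r < L} (r = √(y₁²+y₃²)). Let f ∈ H^{(1−δ,2−δ₀)}_{1,α}(Q) be 2π-periodic in y₂, written f(r, θ, y₂) in cylindrical coordinates. Define, for t > 0, I₀(t) = (2e^t/π)·∫₀¹ e^{−2tu²}(1−u²)^{−1/2} du and K₀(t) = (e^{−t}/√(2t))·∫₀^∞ e^{−u} u^{−1/2}(1 + u/(2t))^{−1/2} du, with derivatives I₀′, K₀′. For n ≥ 1 set f^{(1)}_{0n}(r) = (1/(π(π/2 − θ₀)))·∫_{θ₀}^{π/2}∫₀^{2π} f(r, θ, y₂) sin(ny₂) dy₂ dθ, f^{(2)}_{0n}(r) the same with cos(ny₂), and for i = 1, 2: R^{(i)}_{0n}(r) = (K₀′(nL)/I₀′(nL))·I₀(nr)·∫₀^{L} s I₀(ns) f^{(i)}_{0n}(s) ds − I₀(nr)·∫_r^{L} s K₀(ns) f^{(i)}_{0n}(s) ds − K₀(nr)·∫₀^{r} s I₀(ns)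 f^{(i)}_{0n}(s) ds. Then the series I₂(r, y₂) = Σ_{n=1}^{∞} ( R^{(1)}_{0n}(r) sin(ny₂) + R^{(2)}_{0n}(r) cos(ny₂) ) converges absolutely for 0 < r ≤ L and there is a constant C, independent of L and f, such that sup_{0<r≤L, y₂∈ℝ} |I₂(r, y₂)| ≤ C·‖f‖^{(1−δ,2−δ₀)}_{1,α;Q}. -/

import Mathlib

noncomputable section

open Real Set Filter MeasureTheory Topology

/-- Points of `ℝ³` (Euclidean). -/
abbrev V3 : Type := EuclideanSpace ℝ (Fin 3)

/-- `r_x = √(x₁² + x₃²)`, the distance of `x` to the `x₂`-axis. -/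
def rx (x : V3) : ℝ := Real.sqrt (x 0 ^ 2 + x 2 ^ 2)

/-- The edge `{x₁ = x₃ = 0}` (the `x₂`-axis). -/
def edge : Set V3 := {x : V3 | x 0 = 0 ∧ x 2 = 0}

/-- The infinite wedge `Q = {y₁ > 0, y₃ > b₀y₁}`. -/
def wedgeQ (b₀ : ℝ) : Set V3 := {y : V3 | 0 < y 0 ∧ b₀ * y 0 < y 2}

/-- The truncated wedge `Q_L = Q ∩ {r < L}`. -/
def wedgeQL (b₀ L : ℝ) : Set V3 := {y ∈ wedgeQ b₀ | rx y < L}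

/-- `Q̄ ∖ edge`, the natural regularity set for functions on the wedge. -/
def SQ (b₀ : ℝ) : Set V3 := closure (wedgeQ b₀) \ edge

/-- `Q̄_L ∖ edge`. -/
def SL (b₀ L : ℝ) : Set V3 := closure (wedgeQL b₀ L) \ edge

/-- Partial derivative within `S` in the `i`-th coordinate direction. -/
def pdW (S : Set V3) (i : Fin 3) (u : V3 → ℝ) (x : V3) : ℝ :=
  fderivWithin ℝ u S x (EuclideanSpace.single i 1)

/-- Laplacian of `u` at `x` (derivatives taken within `S`). -/
def lapW (S : Set V3) (u : V3 → ℝ) (x : V3) : ℝ :=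
  ∑ i : Fin 3, pdW S i (pdW S i u) x

/-- `2π`-periodicity in `y₂`, on the set `D`. -/
def Per2On (D : Set V3) (u : V3 → ℝ) : Prop :=
  ∀ y ∈ D, u (y + EuclideanSpace.single 1 (2 * Real.pi)) = u y

/-- All weighted sup quantities entering `Σ_{j≤m}[u]^{(k,l)}_{j,0;D}` are `≤ M`
(derivatives taken within `S`). -/
def wsupLE (S : Set V3) (m : ℕ) (k l : ℝ) (D : Set V3) (u : V3 → ℝ) (M : ℝ) : Prop :=
  (∀ j : ℕ, j ≤ m → ∀ x ∈ D, 0 < rx x → rx x < 1 →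
      rx x ^ max (k + j) 0 * ‖iteratedFDerivWithin ℝ j u S x‖ ≤ M) ∧
  (∀ j : ℕ, j ≤ m → ∀ x ∈ D, 1 < rx x →
      rx x ^ (l + j) * ‖iteratedFDerivWithin ℝ j u S x‖ ≤ M)

/-- All quantities entering the weighted Hölder norm `‖u‖^{(k,l)}_{m,α;D}` are `≤ M`
(derivatives taken within `S`). -/
def wnormLE (S : Set V3) (m : ℕ) (α k l : ℝ) (D : Set V3) (u : V3 → ℝ) (M : ℝ) : Prop :=
  wsupLE S m k l D u M ∧
  (∀ x ∈ D, ∀ y ∈ D, 0 < min (rx x) (rx y) → min (rx x) (rx y) < 1 →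
      min (rx x) (rx y) ^ max (k + m + α) 0 *
        ‖iteratedFDerivWithin ℝ m u S x - iteratedFDerivWithin ℝ m u S y‖ ≤
        M * ‖x - y‖ ^ α) ∧
  (∀ x ∈ D, ∀ y ∈ D, 1 < min (rx x) (rx y) →
      min (rx x) (rx y) ^ (l + m + α) *
        ‖iteratedFDerivWithin ℝ m u S x - iteratedFDerivWithin ℝ m u S y‖ ≤
        M * ‖x - y‖ ^ α)

/-- Membership in the weighted Hölder space `H^{(k,l)}_{m,α}(D)`. -/
def memH (S : Set V3) (m : ℕ) (α k l : ℝ) (D : Set V3) (u : V3 → ℝ) : Prop :=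
  ContDiffOn ℝ m u S ∧ ∃ M : ℝ, 0 ≤ M ∧ wnormLE S m α k l D u M

/-- The point of `ℝ³` with cylindrical coordinates `(r, θ, y₂)`:
`(r cos θ, y₂, r sin θ)`. -/
def mk3 (a b c : ℝ) : V3 := (WithLp.equiv 2 (Fin 3 → ℝ)).symm ![a, b, c]

/-- `f` written in cylindrical coordinates: `f(r cos θ, y₂, r sin θ)`. -/
def fPolar (f : V3 → ℝ) (r θ y₂ : ℝ) : ℝ := f (mk3 (r * Real.cos θ) y₂ (r * Real.sin θ))

/-- Modified Bessel function of the first kind of order `0`, by its integral representation. -/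
def besselI0 (t : ℝ) : ℝ :=
  2 * Real.exp t / Real.pi *
    ∫ u in (0:ℝ)..1, Real.exp (-2 * t * u ^ 2) * (1 - u ^ 2) ^ (-(1:ℝ)/2)

/-- Modified Bessel function of the second kind of order `0`, by its integral representation. -/
def besselK0 (t : ℝ) : ℝ :=
  Real.exp (-t) / Real.sqrt (2 * t) *
    ∫ u in Set.Ioi (0:ℝ), Real.exp (-u) * u ^ (-(1:ℝ)/2) * (1 + u / (2 * t)) ^ (-(1:ℝ)/2)

/-- The Fourier coefficient `f^{(1)}_{0n}(r)` (against `sin(ny₂)`). -/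
def f0n1 (b₀ : ℝ) (f : V3 → ℝ) (n : ℕ) (r : ℝ) : ℝ :=
  (Real.pi * (Real.pi / 2 - Real.arctan b₀))⁻¹ *
    ∫ θ in (Real.arctan b₀)..(Real.pi / 2), ∫ y₂ in (0:ℝ)..(2 * Real.pi),
      fPolar f r θ y₂ * Real.sin (n * y₂)

/-- The Fourier coefficient `f^{(2)}_{0n}(r)` (against `cos(ny₂)`). -/
def f0n2 (b₀ : ℝ) (f : V3 → ℝ) (n : ℕ) (r : ℝ) : ℝ :=
  (Real.pi * (Real.pi / 2 - Real.arctan b₀))⁻¹ *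
    ∫ θ in (Real.arctan b₀)..(Real.pi / 2), ∫ y₂ in (0:ℝ)..(2 * Real.pi),
      fPolar f r θ y₂ * Real.cos (n * y₂)

/-- The radial mode `R^{(i)}_{0n}(r)` of (4.25), for the coefficient function `g = f^{(i)}_{0n}`. -/
def R0n (L : ℝ) (g : ℝ → ℝ) (n : ℕ) (r : ℝ) : ℝ :=
  deriv besselK0 (n * L) / deriv besselI0 (n * L) * besselI0 (n * r) *
      (∫ s in (0:ℝ)..L, s * besselI0 (n * s) * g s) -
    besselI0 (n * r) * (∫ s in r..L, s * besselK0 (n * s) * g s) -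
    besselK0 (n * r) * ∫ s in (0:ℝ)..r, s * besselI0 (n * s) * g s


/-- weight of the `I₀` integral -/
def wI (u : ℝ) : ℝ := (1 - u ^ 2) ^ (-(1:ℝ)/2)

theorem wI_nonneg {u : ℝ} (h0 : 0 ≤ u) (h1 : u ≤ 1) : 0 ≤ wI u := by
  unfold wI
  apply Real.rpow_nonneg
  nlinarith

theorem wI_arcsin : ∀ u ∈ Ioo (0:ℝ) 1, HasDerivAt Real.arcsin (wI u) u := by
  intro u hu
  have h := Real.hasDerivAt_arcsin (x := u) (by linarith [hu.1]) (by linarith [hu.2])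
  have : wI u = 1 / √(1 - u ^ 2) := by
    unfold wI
    rw [Real.sqrt_eq_rpow, neg_div, Real.rpow_neg (by nlinarith [hu.1, hu.2]), one_div ((1 - u ^ 2) ^ _)]
  rw [this]; exact h

theorem wI_int : IntervalIntegrable wI volume 0 1 := by
  apply intervalIntegral.intervalIntegrable_deriv_of_nonneg (g := Real.arcsin)
  · exact Real.continuous_arcsin.continuousOn
  · simpa using wI_arcsin
  · intro x hx
    simp at hx
    exact wI_nonneg hx.1.le hx.2.le

theorem wI_integral : ∫ u in (0:ℝ)..1, wI u = π / 2 := by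
  rw [intervalIntegral.integral_eq_sub_of_hasDerivAt_of_le zero_le_one
    Real.continuous_arcsin.continuousOn wI_arcsin wI_int]
  simp

/-- reduced form of `I₀` -/
def JI (t : ℝ) : ℝ := ∫ u in (0:ℝ)..1, Real.exp (t * (1 - 2 * u ^ 2)) * wI u

theorem besselI0_eq (t : ℝ) : besselI0 t = 2 / π * JI t := by
  unfold besselI0 JI wI
  rw [mul_comm 2 (Real.exp t), mul_div_assoc, mul_comm (Real.exp t), mul_assoc,
    ← intervalIntegral.integral_const_mul]
  congr 1
  apply intervalIntegral.integral_congr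
  intro u _
  simp only
  rw [← mul_assoc, ← Real.exp_add]
  congr 2; ring

theorem JI_int (t : ℝ) : IntervalIntegrable
    (fun u => Real.exp (t * (1 - 2 * u ^ 2)) * wI u) volume 0 1 :=
  wI_int.continuousOn_mul (by fun_prop)

theorem JI'_int (c t : ℝ) : IntervalIntegrable
    (fun u => (1 - 2 * u ^ 2 - c) * Real.exp (t * (1 - 2 * u ^ 2)) * wI u) volume 0 1 :=
  wI_int.continuousOn_mul (by fun_prop)

theorem JI_deriv (t : ℝ) : HasDerivAt JI
    (∫ u in (0:ℝ)..1, (1 - 2 * u ^ 2) * Real.exp (t * (1 - 2 * u ^ 2)) * wI u) t := by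
  have := intervalIntegral.hasDerivAt_integral_of_dominated_loc_of_deriv_le (𝕜 := ℝ) (μ := volume)
    (a := 0) (b := 1)
    (F := fun t u => Real.exp (t * (1 - 2 * u ^ 2)) * wI u)
    (F' := fun t u => (1 - 2 * u ^ 2) * Real.exp (t * (1 - 2 * u ^ 2)) * wI u)
    (x₀ := t) (s := Metric.ball t 1) (bound := fun u => Real.exp (|t| + 1) * wI u)
    (Metric.ball_mem_nhds t one_pos)
    (Eventually.of_forall fun x => (JI_int x).def'.aestronglyMeasurable) (JI_int t)
    (by simpa using (JI'_int 0 t).def'.aestronglyMeasurable) ?_ (wI_int.const_mul _) ?_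
  · exact this.2
  · refine Eventually.of_forall fun u hu x hx => ?_
    rw [uIoc_of_le zero_le_one] at hu
    have hw := wI_nonneg hu.1.le hu.2
    have hk : |1 - 2 * u ^ 2| ≤ 1 := by
      rw [abs_le]; constructor <;> nlinarith [hu.1, hu.2]
    have hx' : |x| ≤ |t| + 1 := by
      rw [Metric.mem_ball, Real.dist_eq] at hx
      have := abs_sub_abs_le_abs_sub x t
      linarith
    rw [norm_mul, norm_mul, Real.norm_eq_abs, Real.norm_eq_abs, Real.norm_eq_abs, Real.abs_exp,
      abs_of_nonneg hw]
    apply mul_le_mul_of_nonneg_right _ hw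
    have h1 : Real.exp (x * (1 - 2 * u ^ 2)) ≤ Real.exp (|t| + 1) := by
      apply Real.exp_le_exp.2
      calc _ ≤ |x * (1 - 2 * u ^ 2)| := le_abs_self _
        _ = |x| * |1 - 2 * u ^ 2| := abs_mul _ _
        _ ≤ |x| * 1 := by gcongr
        _ ≤ _ := by linarith
    calc _ ≤ 1 * Real.exp (|t| + 1) := by gcongr
      _ = _ := one_mul _
  · refine Eventually.of_forall fun u hu x hx => ?_
    have h : HasDerivAt (fun x : ℝ => x * (1 - 2 * u ^ 2)) (1 - 2 * u ^ 2) x := by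
      simpa using (hasDerivAt_id x).mul_const (1 - 2 * u ^ 2)
    have := (h.exp).mul_const (wI u)
    exact this.congr_deriv (by ring)

theorem I0_nonneg (t : ℝ) : 0 ≤ besselI0 t := by
  rw [besselI0_eq]
  apply mul_nonneg (by positivity)
  apply intervalIntegral.integral_nonneg zero_le_one
  intro u hu
  exact mul_nonneg (Real.exp_pos _).le (wI_nonneg hu.1 hu.2)

theorem I0_le (t : ℝ) (ht : 0 ≤ t) : besselI0 t ≤ Real.exp t := by
  have : JI t ≤ ∫ u in (0:ℝ)..1, Real.exp t * wI u := by
    apply intervalIntegral.integral_mono_on zero_le_one (JI_int t) (wI_int.const_mul _)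
    intro u hu
    apply mul_le_mul_of_nonneg_right _ (wI_nonneg hu.1 hu.2)
    apply Real.exp_le_exp.2
    nlinarith [sq_nonneg u, mul_nonneg ht (sq_nonneg u)]
  rw [intervalIntegral.integral_const_mul, wI_integral] at this
  rw [besselI0_eq]
  calc _ ≤ 2 / π * (Real.exp t * (π / 2)) := by gcongr
    _ = _ := by field_simp

theorem JI_le (x X : ℝ) (hx : 0 ≤ x) (hX : x ≤ X) : JI x ≤ JI X + π / 2 := by
  rw [← wI_integral, JI, JI, ← intervalIntegral.integral_add (JI_int X) wI_int]
  apply intervalIntegral.integral_mono_on zero_le_one (JI_int x) ((JI_int X).add wI_int)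
  intro u hu
  have hw := wI_nonneg hu.1 hu.2
  have : Real.exp (x * (1 - 2 * u ^ 2)) ≤ Real.exp (X * (1 - 2 * u ^ 2)) + 1 := by
    rcases le_total 0 (1 - 2 * u ^ 2) with h | h
    · have : Real.exp (x * (1 - 2 * u ^ 2)) ≤ Real.exp (X * (1 - 2 * u ^ 2)) :=
        Real.exp_le_exp.2 (by nlinarith)
      linarith
    · have : Real.exp (x * (1 - 2 * u ^ 2)) ≤ 1 := Real.exp_le_one_iff.2 (by nlinarith)
      have := Real.exp_pos (X * (1 - 2 * u ^ 2))
      linarith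
  nlinarith

theorem xexp_lower (x X : ℝ) (hX : 4 ≤ X) : -(1/4) ≤ x * Real.exp (X * x) := by
  rcases le_total 0 x with h | h
  · have := mul_nonneg h (Real.exp_pos (X * x)).le
    linarith
  · have h1 : Real.exp (X * x) ≤ Real.exp (4 * x) := Real.exp_le_exp.2 (by nlinarith)
    have h2 : x * Real.exp (4 * x) ≤ x * Real.exp (X * x) := mul_le_mul_of_nonpos_left h1 h
    have h3 : (-(4 * x)) ≤ Real.exp (-(4 * x)) := by linarith [Real.add_one_le_exp (-(4 * x))]
    have h4 : Real.exp (-(4 * x)) * Real.exp (4 * x) = 1 := by rw [← Real.exp_add]; simp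
    nlinarith [Real.exp_pos (4 * x)]

theorem JI'_lower (X : ℝ) (hX : 4 ≤ X) :
    JI X / 8 + 1 / 4 ≤ ∫ u in (0:ℝ)..1, (1 - 2 * u ^ 2) * Real.exp (X * (1 - 2 * u ^ 2)) * wI u := by
  have e1 : (∫ u in (0:ℝ)..1, (1 - 2 * u ^ 2) * Real.exp (X * (1 - 2 * u ^ 2)) * wI u) - JI X / 8
      = Real.exp (X / 8) * ∫ u in (0:ℝ)..1,
        (1 - 2 * u ^ 2 - 1/8) * Real.exp (X * (1 - 2 * u ^ 2 - 1 / 8)) * wI u := by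
    have i0 := JI'_int 0 X
    simp only [sub_zero] at i0
    rw [JI, div_eq_mul_inv, mul_comm _ (8:ℝ)⁻¹, ← intervalIntegral.integral_const_mul,
      ← intervalIntegral.integral_sub i0 ((JI_int X).const_mul _),
      ← intervalIntegral.integral_const_mul]
    apply intervalIntegral.integral_congr
    intro u _
    have : Real.exp (X * (1 - 2 * u ^ 2)) = Real.exp (X / 8) * Real.exp (X * (1 - 2 * u ^ 2 - 1 / 8)) := by
      rw [← Real.exp_add]; congr 1; ring
    simp only [this]
    ring
  set F : ℝ → ℝ := fun u => (1 - 2 * u ^ 2 - 1/8) * Real.exp (X * (1 - 2 * u ^ 2 - 1 / 8)) * wI u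
    with hF
  have hFi : IntervalIntegrable F volume 0 1 := wI_int.continuousOn_mul (by fun_prop)
  have hFa : IntervalIntegrable F volume 0 (1/2) := hFi.mono_set (by
    rw [uIcc_of_le (by norm_num), uIcc_of_le (by norm_num)]; exact Icc_subset_Icc_right (by norm_num))
  have hFb : IntervalIntegrable F volume (1/2) 1 := hFi.mono_set (by
    rw [uIcc_of_le (by norm_num), uIcc_of_le (by norm_num)]; exact Icc_subset_Icc_left (by norm_num))
  have hwa : IntervalIntegrable wI volume 0 (1/2) := wI_int.mono_set (by
    rw [uIcc_of_le (by norm_num), uIcc_of_le (by norm_num)]; exact Icc_subset_Icc_right (by norm_num))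
  have hwb : IntervalIntegrable wI volume (1/2) 1 := wI_int.mono_set (by
    rw [uIcc_of_le (by norm_num), uIcc_of_le (by norm_num)]; exact Icc_subset_Icc_left (by norm_num))
  have ha : (∫ u in (0:ℝ)..(1/2), (1.4:ℝ)) ≤ ∫ u in (0:ℝ)..(1/2), F u := by
    apply intervalIntegral.integral_mono_on (by norm_num) (by simp) hFa
    intro u hu
    have hw : 1 ≤ wI u := by
      unfold wI
      apply Real.one_le_rpow_of_pos_of_le_one_of_nonpos
      · nlinarith [hu.1, hu.2]
      · nlinarith [hu.1, hu.2]
      · norm_num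
    have hx : 3 / 8 ≤ 1 - 2 * u ^ 2 - 1/8 := by nlinarith [hu.1, hu.2]
    have hex : 4 ≤ Real.exp (X * (1 - 2 * u ^ 2 - 1 / 8)) := by
      have h1 : Real.exp (3/2) ≤ Real.exp (X * (1 - 2 * u ^ 2 - 1 / 8)) :=
        Real.exp_le_exp.2 (by nlinarith)
      have h2 : (4:ℝ) ≤ Real.exp (3/2) := by
        have h3 : Real.exp (3/2) ^ 2 = Real.exp 1 ^ 3 := by
          rw [← Real.exp_nat_mul, ← Real.exp_nat_mul]; norm_num
        have h4 : (2.7:ℝ) ≤ Real.exp 1 := by linarith [Real.exp_one_gt_d9]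
        have h5 : (2.7:ℝ) ^ 3 ≤ Real.exp 1 ^ 3 := by gcongr
        nlinarith [Real.exp_pos (3/2)]
      linarith
    have : (1.4:ℝ) ≤ (1 - 2 * u ^ 2 - 1/8) * Real.exp (X * (1 - 2 * u ^ 2 - 1 / 8)) := by
      nlinarith
    simp only [hF]
    nlinarith
  have hb : (∫ u in (1/2:ℝ)..1, (-(1/4:ℝ)) * wI u) ≤ ∫ u in (1/2:ℝ)..1, F u := by
    apply intervalIntegral.integral_mono_on (by norm_num) (hwb.const_mul _) hFb
    intro u hu
    apply mul_le_mul_of_nonneg_right (xexp_lower _ X hX) (wI_nonneg (by linarith [hu.1]) hu.2)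
  have hw0 : 0 ≤ ∫ u in (0:ℝ)..(1/2), wI u :=
    intervalIntegral.integral_nonneg (by norm_num)
      fun u hu => wI_nonneg hu.1 (by linarith [hu.2])
  have hsum := intervalIntegral.integral_add_adjacent_intervals hFa hFb
  have hwsum := intervalIntegral.integral_add_adjacent_intervals hwa hwb
  rw [wI_integral] at hwsum
  rw [intervalIntegral.integral_const_mul] at hb
  rw [intervalIntegral.integral_const] at ha
  norm_num at ha
  have hF1 : 1 / 4 ≤ ∫ u in (0:ℝ)..1, F u := by
    have := Real.pi_lt_d2
    linarith
  have hE : 1 ≤ Real.exp (X / 8) := Real.one_le_exp (by linarith)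
  nlinarith

theorem I0_deriv_lower (x X : ℝ) (hx : 0 ≤ x) (hxX : x ≤ X) (hX : 4 ≤ X) :
    0 < deriv besselI0 X ∧ besselI0 x ≤ 8 * deriv besselI0 X := by
  have h : besselI0 = fun t => 2 / π * JI t := funext besselI0_eq
  have h1 := JI'_lower X hX
  have h2 := JI_le x X hx hxX
  have h3 : 0 ≤ JI X := by
    have := I0_nonneg X
    rw [besselI0_eq] at this
    exact nonneg_of_mul_nonneg_right this (by positivity)
  rw [h, ((JI_deriv X).const_mul (2 / π)).deriv]
  have hp : 0 < 2 / π := by positivity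
  refine ⟨mul_pos hp (by linarith), ?_⟩
  simp only
  rw [mul_left_comm]
  apply mul_le_mul_of_nonneg_left _ hp.le
  have := Real.pi_lt_d2
  linarith

/-- weight of the `K₀` integral -/
def wK (u : ℝ) : ℝ := Real.exp (-u) * u ^ (-(1:ℝ)/2)

theorem wK_nonneg {u : ℝ} (h : 0 < u) : 0 ≤ wK u := by unfold wK; positivity

theorem wK_int : IntegrableOn wK (Ioi 0) := by
  have := Real.GammaIntegral_convergent (s := 1/2) (by norm_num)
  have e : (1/2 - 1 : ℝ) = -(1:ℝ)/2 := by norm_num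
  rw [e] at this
  exact this

theorem wK_integral : ∫ u in Ioi (0:ℝ), wK u ≤ 2 := by
  have h := Real.Gamma_eq_integral (s := 1/2) (by norm_num)
  have e : (1/2 - 1 : ℝ) = -(1:ℝ)/2 := by norm_num
  rw [e, Real.Gamma_one_half_eq] at h
  have : (∫ u in Ioi (0:ℝ), wK u) = √π := h.symm
  rw [this, Real.sqrt_le_left (by norm_num)]
  linarith [Real.pi_lt_four]

theorem wK_integral_nonneg : 0 ≤ ∫ u in Ioi (0:ℝ), wK u :=
  setIntegral_nonneg measurableSet_Ioi fun _ hu => wK_nonneg hu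

/-- the integral in `K₀` -/
def GK (t : ℝ) : ℝ := ∫ u in Ioi (0:ℝ), wK u * (1 + u / (2 * t)) ^ (-(1:ℝ)/2)

theorem besselK0_eq (t : ℝ) : besselK0 t = Real.exp (-t) / √(2 * t) * GK t := rfl

theorem phi_le {u t : ℝ} (hu : 0 < u) (ht : 0 < t) : (1 + u / (2 * t)) ^ (-(1:ℝ)/2) ≤ 1 := by
  apply Real.rpow_le_one_of_one_le_of_nonpos
  · have : 0 < u / (2 * t) := by positivity
    linarith
  · norm_num

theorem phi_meas (p t : ℝ) :
    AEStronglyMeasurable (fun u : ℝ => (1 + u / (2 * t)) ^ p) (volume.restrict (Ioi 0)) := by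
  have : Measurable (fun u : ℝ => (1 + u / (2 * t)) ^ p) := by fun_prop
  exact this.aestronglyMeasurable

theorem GK_int (t : ℝ) (ht : 0 < t) :
    IntegrableOn (fun u => wK u * (1 + u / (2 * t)) ^ (-(1:ℝ)/2)) (Ioi 0) := by
  refine Integrable.mono' wK_int (wK_int.aestronglyMeasurable.mul (phi_meas _ _)) ?_
  refine (ae_restrict_iff' measurableSet_Ioi).2 (Eventually.of_forall fun u (hu : 0 < u) => ?_)
  have h0 := wK_nonneg hu
  have h1 := phi_le hu ht
  have h2 : 0 ≤ (1 + u / (2 * t)) ^ (-(1:ℝ)/2) := by positivity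
  rw [Real.norm_eq_abs, abs_of_nonneg (mul_nonneg h0 h2)]
  nlinarith

theorem GK_nonneg (t : ℝ) (ht : 0 < t) : 0 ≤ GK t := by
  apply setIntegral_nonneg measurableSet_Ioi
  intro u (hu : 0 < u)
  have h0 := wK_nonneg hu
  positivity

theorem GK_le (t : ℝ) (ht : 0 < t) : GK t ≤ 2 := by
  refine le_trans ?_ wK_integral
  apply setIntegral_mono_on (GK_int t ht) wK_int measurableSet_Ioi
  intro u (hu : 0 < u)
  have h0 := wK_nonneg hu
  have h1 := phi_le hu ht
  nlinarith

theorem K0_nonneg (t : ℝ) (ht : 0 < t) : 0 ≤ besselK0 t := by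
  rw [besselK0_eq]
  have := GK_nonneg t ht
  positivity

theorem pre_le (t : ℝ) (ht : 0 < t) :
    Real.exp (-t) / √(2 * t) ≤ Real.exp (-t) * t ^ (-(1:ℝ)/2) := by
  have : t ^ (-(1:ℝ)/2) = (√t)⁻¹ := by
    rw [Real.sqrt_eq_rpow, neg_div, Real.rpow_neg ht.le]
  rw [this, ← div_eq_mul_inv]
  have : 0 < √t := Real.sqrt_pos.2 ht
  gcongr
  linarith

theorem K0_le (t : ℝ) (ht : 0 < t) : besselK0 t ≤ 2 * (Real.exp (-t) * t ^ (-(1:ℝ)/2)) := by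
  rw [besselK0_eq]
  have h1 := GK_nonneg t ht
  have h2 := GK_le t ht
  have h3 := pre_le t ht
  have h4 : 0 ≤ Real.exp (-t) / √(2 * t) := by positivity
  nlinarith

theorem GK_deriv (t : ℝ) (ht : 2 < t) : ∃ g', HasDerivAt GK g' t ∧ |g'| ≤ 2 := by
  have key : ∀ x ∈ Metric.ball t 1, ∀ u : ℝ, 0 < u →
      ‖wK u * (u / (4 * x ^ 2) * (1 + u / (2 * x)) ^ (-(1:ℝ)/2 - 1))‖ ≤ wK u := by
    intro x hx u hu
    rw [Metric.mem_ball, Real.dist_eq, abs_lt] at hx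
    have hx1 : 1 < x := by linarith
    have h0 := wK_nonneg hu
    have hb : 0 < 1 + u / (2 * x) := by positivity
    have h1 : (1 + u / (2 * x)) ^ (-(1:ℝ)/2 - 1) ≤ (1 + u / (2 * x)) ^ (-1:ℝ) := by
      apply Real.rpow_le_rpow_of_exponent_le
      · have : 0 < u / (2 * x) := by positivity
        linarith
      · norm_num
    rw [Real.rpow_neg_one] at h1
    have h2 : u / (4 * x ^ 2) * (1 + u / (2 * x)) ^ (-(1:ℝ)/2 - 1) ≤ 1 := by
      calc _ ≤ u / (4 * x ^ 2) * (1 + u / (2 * x))⁻¹ := by gcongr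
        _ ≤ 1 := by
          rw [← div_eq_mul_inv, div_le_one hb]
          have : u / (4 * x ^ 2) ≤ u / (2 * x) := by
            apply div_le_div_of_nonneg_left hu.le (by positivity)
            nlinarith
          linarith
    have h3 : 0 ≤ u / (4 * x ^ 2) * (1 + u / (2 * x)) ^ (-(1:ℝ)/2 - 1) := by positivity
    rw [Real.norm_eq_abs, abs_of_nonneg (mul_nonneg h0 h3)]
    nlinarith
  have := hasDerivAt_integral_of_dominated_loc_of_deriv_le (𝕜 := ℝ) (μ := volume.restrict (Ioi 0))
    (F := fun t u => wK u * (1 + u / (2 * t)) ^ (-(1:ℝ)/2))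
    (F' := fun x u => wK u * (u / (4 * x ^ 2) * (1 + u / (2 * x)) ^ (-(1:ℝ)/2 - 1)))
    (x₀ := t) (s := Metric.ball t 1) (bound := wK)
    (Metric.ball_mem_nhds t one_pos)
    (Eventually.of_forall fun x => wK_int.aestronglyMeasurable.mul (phi_meas _ _))
    (GK_int t (by linarith)) ?_ ?_ wK_int ?_
  · refine ⟨_, this.2, ?_⟩
    refine le_trans ?_ wK_integral
    rw [← Real.norm_eq_abs]
    apply MeasureTheory.norm_integral_le_of_norm_le wK_int
    refine (ae_restrict_iff' measurableSet_Ioi).2 (Eventually.of_forall fun u (hu : 0 < u) => ?_)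
    exact key t (Metric.mem_ball_self one_pos) u hu
  · refine wK_int.aestronglyMeasurable.mul (AEStronglyMeasurable.mul ?_ (phi_meas _ _))
    have : Measurable (fun u : ℝ => u / (4 * t ^ 2)) := by fun_prop
    exact this.aestronglyMeasurable
  · refine (ae_restrict_iff' measurableSet_Ioi).2 (Eventually.of_forall fun u (hu : 0 < u) => ?_)
    exact fun x hx => key x hx u hu
  · refine (ae_restrict_iff' measurableSet_Ioi).2 (Eventually.of_forall fun u (hu : 0 < u) => ?_)
    intro x hx
    rw [Metric.mem_ball, Real.dist_eq, abs_lt] at hx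
    have hx1 : 0 < x := by linarith
    have hb : 0 < 1 + u / (2 * x) := by positivity
    have h1 : HasDerivAt (fun x : ℝ => 1 + u / (2 * x)) (-(u / (2 * x ^ 2))) x := by
      have := (((hasDerivAt_id x).const_mul 2).fun_inv (by simp; exact hx1.ne')).const_mul u
      have := this.const_add 1
      simp only [id, ← div_eq_mul_inv] at this
      refine this.congr_deriv ?_
      field_simp
    have h2 := h1.rpow_const (p := -(1:ℝ)/2) (Or.inl hb.ne')
    refine (h2.const_mul (wK u)).congr_deriv ?_
    field_simp
    ring

theorem K0_deriv_le (X : ℝ) (hX : 4 ≤ X) :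
    |deriv besselK0 X| ≤ 8 * (Real.exp (-X) * X ^ (-(1:ℝ)/2)) := by
  obtain ⟨g', hg, hg'⟩ := GK_deriv X (by linarith)
  have hX0 : 0 < X := by linarith
  have h2X : 0 < 2 * X := by linarith
  have hs : 0 < √(2 * X) := Real.sqrt_pos.2 h2X
  have hp : HasDerivAt (fun t : ℝ => Real.exp (-t) / √(2 * t))
      (-(Real.exp (-X) / √(2 * X) * (1 + 1 / (2 * X)))) X := by
    have h1 : HasDerivAt (fun t : ℝ => Real.exp (-t)) (-Real.exp (-X)) X := by
      simpa using (hasDerivAt_id X).fun_neg.exp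
    have h2 : HasDerivAt (fun t : ℝ => √(2 * t)) (1 / √(2 * X)) X := by
      have := ((hasDerivAt_id X).const_mul 2).sqrt (by simpa using hX0.ne')
      refine this.congr_deriv ?_
      simp
      field_simp
    refine (h1.fun_div h2 hs.ne').congr_deriv ?_
    have : √(X * 2) ^ 2 = X * 2 := Real.sq_sqrt (by linarith)
    field_simp
    ring_nf
    rw [this]
    ring
  have hd : deriv besselK0 X = _ := (hp.mul hg).deriv
  rw [hd]
  have hP : 0 ≤ Real.exp (-X) / √(2 * X) := by positivity
  have h3 := pre_le X hX0
  have hG := GK_le X hX0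
  have hG0 := GK_nonneg X hX0
  have hh : 1 / (2 * X) ≤ 1 := by rw [div_le_one h2X]; linarith
  have hh0 : 0 ≤ 1 / (2 * X) := by positivity
  set P := Real.exp (-X) / √(2 * X)
  set q := 1 / (2 * X)
  have t1 : |(-(P * (1 + q))) * GK X| ≤ 4 * P := by
    rw [abs_mul, abs_neg, abs_of_nonneg (by positivity), abs_of_nonneg hG0]
    calc _ ≤ P * (1 + 1) * 2 := by gcongr
      _ = _ := by ring
  have t2 : |P * g'| ≤ 2 * P := by
    rw [abs_mul, abs_of_nonneg hP]; nlinarith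
  calc _ ≤ _ := abs_add_le _ _
    _ ≤ 4 * P + 2 * P := add_le_add t1 t2
    _ ≤ _ := by linarith

theorem exp_int_bound (N r d : ℝ) (hN : 0 < N) (hr : 0 < r) (hd0 : 0 < d) (hd : d ≤ 1/2) :
    ∫ s in (0:ℝ)..r, s ^ d * Real.exp (N * s) ≤
      r ^ (1/2:ℝ) * N ^ (-(1:ℝ)/2 - d) * Real.exp (N * r) := by
  have hi : IntervalIntegrable (fun s : ℝ => Real.exp (N * s)) volume 0 r :=
    (by fun_prop : Continuous fun s : ℝ => Real.exp (N * s)).intervalIntegrable _ _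
  have h1 : ∫ s in (0:ℝ)..r, s ^ d * Real.exp (N * s) ≤
      ∫ s in (0:ℝ)..r, r ^ d * Real.exp (N * s) := by
    apply intervalIntegral.integral_mono_on hr.le _ (hi.const_mul _)
    · intro s hs
      have := hs.1
      have := hs.2
      gcongr
    · apply ContinuousOn.intervalIntegrable
      intro s hs
      exact ((Real.continuousAt_rpow_const _ _ (Or.inr hd0.le)).mul
        (by fun_prop)).continuousWithinAt
  have h2 : ∫ s in (0:ℝ)..r, Real.exp (N * s) = (Real.exp (N * r) - 1) / N := by
    rw [intervalIntegral.integral_comp_mul_left (fun s => Real.exp s) hN.ne', integral_exp]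
    simp
    field_simp
  rw [intervalIntegral.integral_const_mul, h2] at h1
  refine h1.trans ?_
  have hx : 0 < N * r := by positivity
  have h3 : Real.exp (N * r) - 1 ≤ Real.exp (N * r) * (N * r) ^ (1/2 - d) := by
    have hE := Real.exp_pos (N * r)
    rcases le_total 1 (N * r) with h | h
    · have : 1 ≤ (N * r) ^ (1/2 - d) := Real.one_le_rpow h (by linarith)
      nlinarith
    · have h4 : (N * r) ^ (1:ℝ) ≤ (N * r) ^ (1/2 - d) :=
        Real.rpow_le_rpow_of_exponent_ge hx h (by linarith)
      rw [Real.rpow_one] at h4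
      have h5 := Real.add_one_le_exp (-(N * r))
      have h6 : Real.exp (N * r) * Real.exp (-(N * r)) = 1 := by rw [← Real.exp_add]; simp
      nlinarith
  calc r ^ d * ((Real.exp (N * r) - 1) / N)
      ≤ r ^ d * ((Real.exp (N * r) * (N * r) ^ (1/2 - d)) / N) := by gcongr
    _ = (r ^ d * r ^ (1/2 - d)) * (N ^ (1/2 - d) * N⁻¹) * Real.exp (N * r) := by
        rw [Real.mul_rpow hN.le hr.le]; ring
    _ = _ := by
        rw [← Real.rpow_add hr, ← Real.rpow_neg_one N, ← Real.rpow_add hN]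
        congr 3 <;> ring

theorem ae_ne_one : ∀ᵐ s : ℝ, s ≠ 1 := by
  simp [ae_iff]

theorem I_part (N r d A : ℝ) (g : ℝ → ℝ) (hN : 0 < N) (hr : 0 < r) (hd0 : 0 < d) (hd : d ≤ 1/2)
    (hA : 0 ≤ A) (hg : ∀ s, 0 < s → s ≠ 1 → |g s| ≤ A * s ^ (d - 1)) :
    |∫ s in (0:ℝ)..r, s * besselI0 (N * s) * g s| ≤
      A * (r ^ (1/2:ℝ) * N ^ (-(1:ℝ)/2 - d) * Real.exp (N * r)) := by
  refine le_trans ?_ (mul_le_mul_of_nonneg_left (exp_int_bound N r d hN hr hd0 hd) hA)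
  rw [← intervalIntegral.integral_const_mul, ← Real.norm_eq_abs]
  apply intervalIntegral.norm_integral_le_of_norm_le hr.le
  · filter_upwards [ae_ne_one] with s hs1 hs
    have hs0 : 0 < s := hs.1
    have h1 := I0_nonneg (N * s)
    have h2 := I0_le (N * s) (by positivity)
    have h3 := hg s hs0 hs1
    rw [Real.norm_eq_abs, abs_mul, abs_of_nonneg (mul_nonneg hs0.le h1)]
    calc _ ≤ s * Real.exp (N * s) * (A * s ^ (d - 1)) := by gcongr
      _ = A * ((s ^ (1:ℝ) * s ^ (d - 1)) * Real.exp (N * s)) := by rw [Real.rpow_one]; ring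
      _ = _ := by rw [← Real.rpow_add hs0]; congr 3; ring
  · apply ContinuousOn.intervalIntegrable
    intro s hs
    exact (continuousAt_const.mul ((Real.continuousAt_rpow_const _ _ (Or.inr hd0.le)).mul
        (by fun_prop))).continuousWithinAt

theorem K_part (N r L d A : ℝ) (g : ℝ → ℝ) (hN : 0 < N) (hr : 0 < r) (hL : r ≤ L) (hd0 : 0 < d)
    (hd : d ≤ 1/2)
    (hA : 0 ≤ A) (hg : ∀ s, 0 < s → s ≠ 1 → |g s| ≤ A * s ^ (d - 1)) :
    |∫ s in r..L, s * besselK0 (N * s) * g s| ≤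
      2 * A * N ^ (-(1:ℝ)/2) * Real.exp (-(N * r)) * (N ^ (-(1:ℝ)/2 - d) * Real.Gamma (d + 1/2)) := by
  have hG := Real.integral_rpow_mul_exp_neg_mul_Ioi (a := d + 1/2) (by linarith) hN
  set h : ℝ → ℝ := fun t => t ^ (d + 1/2 - 1) * Real.exp (-(N * t)) with hh
  have hGpos : 0 < Real.Gamma (d + 1/2) := Real.Gamma_pos_of_pos (by linarith)
  have hint : IntegrableOn h (Ioi 0) := .of_integral_ne_zero (by rw [hG]; positivity)
  have hNN : (1 / N) ^ (d + 1/2) = N ^ (-(1:ℝ)/2 - d) := by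
    rw [one_div, Real.inv_rpow hN.le, ← Real.rpow_neg hN.le]; congr 1; ring
  rw [hNN] at hG
  have hint2 : IntervalIntegrable h volume 0 (L - r) := by
    rw [intervalIntegrable_iff_integrableOn_Ioc_of_le (by linarith)]
    exact hint.mono_set Ioc_subset_Ioi_self
  have hint3 : IntervalIntegrable (fun s => h (s - r)) volume r L := by
    simpa using hint2.comp_sub_right r
  have hle : ∫ s in r..L, h (s - r) ≤ N ^ (-(1:ℝ)/2 - d) * Real.Gamma (d + 1/2) := by
    rw [intervalIntegral.integral_comp_sub_right, sub_self,
      intervalIntegral.integral_of_le (by linarith), ← hG]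
    apply setIntegral_mono_set hint
    · refine (ae_restrict_iff' measurableSet_Ioi).2 (Eventually.of_forall fun u (hu : 0 < u) => ?_)
      simp only [hh, Pi.zero_apply]
      positivity
    · exact (Ioc_subset_Ioi_self).eventuallyLE
  refine le_trans ?_ (mul_le_mul_of_nonneg_left hle (by positivity))
  rw [← intervalIntegral.integral_const_mul, ← Real.norm_eq_abs]
  apply intervalIntegral.norm_integral_le_of_norm_le hL _ (hint3.const_mul _)
  filter_upwards [ae_ne_one] with s hs1 hs
  have hsr : 0 < s - r := by linarith [hs.1]
  have hs0 : 0 < s := by linarith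
  have h1 := K0_nonneg (N * s) (by positivity)
  have h2 := K0_le (N * s) (by positivity)
  have h3 := hg s hs0 hs1
  rw [Real.norm_eq_abs, abs_mul, abs_of_nonneg (mul_nonneg hs0.le h1)]
  calc _ ≤ s * (2 * (Real.exp (-(N * s)) * (N * s) ^ (-(1:ℝ)/2))) * (A * s ^ (d - 1)) := by gcongr
    _ = 2 * A * N ^ (-(1:ℝ)/2) * Real.exp (-(N * s)) *
          (s ^ (1:ℝ) * s ^ (-(1:ℝ)/2) * s ^ (d - 1)) := by
        rw [Real.rpow_one, Real.mul_rpow hN.le hs0.le]; ring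
    _ = 2 * A * N ^ (-(1:ℝ)/2) * Real.exp (-(N * s)) * s ^ (d + 1/2 - 1) := by
        rw [← Real.rpow_add hs0, ← Real.rpow_add hs0]; congr 2; ring
    _ ≤ 2 * A * N ^ (-(1:ℝ)/2) * Real.exp (-(N * s)) * (s - r) ^ (d + 1/2 - 1) := by
        apply mul_le_mul_of_nonneg_left _ (by positivity)
        exact Real.rpow_le_rpow_of_nonpos hsr (by linarith) (by linarith)
    _ = _ := by
        have : Real.exp (-(N * s)) = Real.exp (-(N * r)) * Real.exp (-(N * (s - r))) := by
          rw [← Real.exp_add]; congr 1; ring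
        simp only [hh, this]
        ring

theorem R_bound (L r d A : ℝ) (n : ℕ) (g : ℝ → ℝ) (hn : 1 ≤ n) (hr : 0 < r) (hrL : r ≤ L)
    (hL : 4 ≤ L) (hd0 : 0 < d) (hd : d ≤ 1/2)
    (hA : 0 ≤ A) (hg : ∀ s, 0 < s → s ≠ 1 → |g s| ≤ A * s ^ (d - 1)) :
    |R0n L g n r| ≤ (66 + 2 * Real.Gamma (d + 1/2)) * A * (n:ℝ) ^ (-1 - d) := by
  have hN1 : (1:ℝ) ≤ n := by exact_mod_cast hn
  unfold R0n
  generalize (n:ℝ) = N at *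
  have hN : 0 < N := by linarith
  have hL0 : 0 < L := by linarith
  have hNL : 4 ≤ N * L := by nlinarith
  have hGpos : 0 < Real.Gamma (d + 1/2) := Real.Gamma_pos_of_pos (by linarith)
  obtain ⟨hI', hI⟩ := I0_deriv_lower (N * r) (N * L) (by positivity) (by gcongr) hNL
  have hK' := K0_deriv_le (N * L) hNL
  have hI0 := I0_nonneg (N * r)
  have hI1 := I0_le (N * r) (by positivity)
  have hK0 := K0_nonneg (N * r) (by positivity)
  have hK1 := K0_le (N * r) (by positivity)
  have p1 := I_part N L d A g hN hL0 hd0 hd hA hg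
  have p2 := K_part N r L d A g hN hr hrL hd0 hd hA hg
  have p3 := I_part N r d A g hN hr hd0 hd hA hg
  have hNN : N ^ (-(1:ℝ)/2) * N ^ (-(1:ℝ)/2 - d) = N ^ (-1 - d) := by
    rw [← Real.rpow_add hN]; congr 1; ring
  have ee : ∀ x : ℝ, Real.exp (-x) * Real.exp x = 1 := fun x => by rw [← Real.exp_add]; simp
  have rr : ∀ x : ℝ, 0 < x → x ^ (-(1:ℝ)/2) * x ^ (1/2:ℝ) = 1 := fun x hx => by
    rw [← Real.rpow_add hx]; norm_num
  have core : ∀ x : ℝ, 0 < x → (Real.exp (-(N * x)) * (N * x) ^ (-(1:ℝ)/2)) *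
      (A * (x ^ (1/2:ℝ) * N ^ (-(1:ℝ)/2 - d) * Real.exp (N * x))) = A * N ^ (-1 - d) := by
    intro x hx
    rw [Real.mul_rpow hN.le hx.le, ← hNN]
    linear_combination (A * N ^ (-(1:ℝ)/2) * N ^ (-(1:ℝ)/2 - d)) * (ee (N * x)) * (x ^ (-(1:ℝ)/2) * x ^ (1/2:ℝ)) + (A * N ^ (-(1:ℝ)/2) * N ^ (-(1:ℝ)/2 - d)) * rr x hx
  set Z1 := ∫ s in (0:ℝ)..L, s * besselI0 (N * s) * g s
  set Z2 := ∫ s in r..L, s * besselK0 (N * s) * g s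
  set Z3 := ∫ s in (0:ℝ)..r, s * besselI0 (N * s) * g s
  have t1 : |deriv besselK0 (N * L) / deriv besselI0 (N * L) * besselI0 (N * r) * Z1| ≤
      64 * A * N ^ (-1 - d) := by
    rw [abs_mul, abs_mul, abs_div, abs_of_pos hI', abs_of_nonneg hI0]
    have hq : |deriv besselK0 (N * L)| / deriv besselI0 (N * L) * besselI0 (N * r) ≤
        64 * (Real.exp (-(N * L)) * (N * L) ^ (-(1:ℝ)/2)) := by
      calc _ ≤ |deriv besselK0 (N * L)| / deriv besselI0 (N * L) * (8 * deriv besselI0 (N * L)) := by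
            gcongr
        _ = 8 * |deriv besselK0 (N * L)| := by field_simp
        _ ≤ _ := by linarith
    calc _ ≤ 64 * (Real.exp (-(N * L)) * (N * L) ^ (-(1:ℝ)/2)) *
          (A * (L ^ (1/2:ℝ) * N ^ (-(1:ℝ)/2 - d) * Real.exp (N * L))) := by gcongr
      _ = _ := by linear_combination 64 * core L hL0
  have t2 : |besselI0 (N * r) * Z2| ≤ 2 * Real.Gamma (d + 1/2) * A * N ^ (-1 - d) := by
    rw [abs_mul, abs_of_nonneg hI0]
    calc _ ≤ Real.exp (N * r) * (2 * A * N ^ (-(1:ℝ)/2) * Real.exp (-(N * r)) *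
          (N ^ (-(1:ℝ)/2 - d) * Real.Gamma (d + 1/2))) := by gcongr
      _ = _ := by
        rw [← hNN]
        linear_combination (2 * A * N ^ (-(1:ℝ)/2) * (N ^ (-(1:ℝ)/2 - d) * Real.Gamma (d + 1/2))) * ee (N * r)
  have t3 : |besselK0 (N * r) * Z3| ≤ 2 * A * N ^ (-1 - d) := by
    rw [abs_mul, abs_of_nonneg hK0]
    calc _ ≤ 2 * (Real.exp (-(N * r)) * (N * r) ^ (-(1:ℝ)/2)) *
          (A * (r ^ (1/2:ℝ) * N ^ (-(1:ℝ)/2 - d) * Real.exp (N * r))) := by gcongr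
      _ = _ := by linear_combination 2 * core r hr
  rw [abs_le] at t1 t2 t3 ⊢
  constructor <;> linarith [t1.1, t1.2, t2.1, t2.2, t3.1, t3.2]

theorem mk3_mem (b₀ r θ y : ℝ) (hr : 0 < r) (h0 : Real.arctan b₀ < θ) (h1 : θ < π / 2)
    (hb : 0 < b₀) :
    mk3 (r * Real.cos θ) y (r * Real.sin θ) ∈ wedgeQ b₀ := by
  have hθ : -(π / 2) < θ := by linarith [Real.neg_pi_div_two_lt_arctan b₀]
  have hc : 0 < Real.cos θ := Real.cos_pos_of_mem_Ioo ⟨hθ, h1⟩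
  have ht : b₀ < Real.tan θ := by
    have := Real.tan_lt_tan_of_lt_of_lt_pi_div_two (Real.neg_pi_div_two_lt_arctan b₀) h1 h0
    rwa [Real.tan_arctan] at this
  rw [Real.tan_eq_sin_div_cos, lt_div_iff₀ hc] at ht
  refine ⟨?_, ?_⟩
  · simp [mk3]; positivity
  · simp [mk3]; nlinarith

theorem rx_mk3 (r θ y : ℝ) (hr : 0 < r) : rx (mk3 (r * Real.cos θ) y (r * Real.sin θ)) = r := by
  have : (r * Real.cos θ) ^ 2 + (r * Real.sin θ) ^ 2 = r ^ 2 := by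
    linear_combination r ^ 2 * Real.sin_sq_add_cos_sq θ
  simp [rx, mk3, this, Real.sqrt_sq hr.le]

theorem f_bound (b₀ α δ δ₀ d M : ℝ) (hb₀ : 0 < b₀) (hδ1 : δ < 1) (hδ₀1 : δ₀ < 1) (hd0 : 0 < d)
    (hdδ : d ≤ δ) (f : V3 → ℝ) (hM : 0 ≤ M)
    (hf : wnormLE (SQ b₀) 1 α (1 - δ) (2 - δ₀) (wedgeQ b₀) f M)
    (r θ y : ℝ) (hr : 0 < r) (hr1 : r ≠ 1) (h0 : Real.arctan b₀ < θ) (h1 : θ < π / 2) :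
    |fPolar f r θ y| ≤ M * r ^ (d - 1) := by
  have hm := mk3_mem b₀ r θ y hr h0 h1 hb₀
  have hx := rx_mk3 r θ y hr
  unfold fPolar
  set x := mk3 (r * Real.cos θ) y (r * Real.sin θ)
  have key : ∀ p : ℝ, r ^ p * |f x| ≤ M → r ^ (-p) ≤ r ^ (d - 1) → |f x| ≤ M * r ^ (d - 1) := by
    intro p hp hq
    have e : r ^ (-p) * r ^ p = 1 := by rw [← Real.rpow_add hr]; simp
    calc |f x| = r ^ (-p) * (r ^ p * |f x|) := by rw [← mul_assoc, e, one_mul]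
      _ ≤ r ^ (d - 1) * M := by gcongr
      _ = _ := mul_comm _ _
  rcases lt_or_gt_of_ne hr1 with h | h
  · have := hf.1.1 0 (by norm_num) x hm (by rw [hx]; exact hr) (by rw [hx]; exact h)
    rw [hx, norm_iteratedFDerivWithin_zero, Real.norm_eq_abs] at this
    refine key _ this ?_
    apply Real.rpow_le_rpow_of_exponent_ge hr h.le
    have : max (1 - δ + ((0:ℕ):ℝ)) 0 = 1 - δ := by
      rw [max_eq_left] <;> simp; linarith
    rw [this]; linarith
  · have := hf.1.2 0 (by norm_num) x hm (by rw [hx]; exact h)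
    rw [hx, norm_iteratedFDerivWithin_zero, Real.norm_eq_abs] at this
    refine key _ this ?_
    apply Real.rpow_le_rpow_of_exponent_le h.le
    simp; linarith

theorem coef_bound (b₀ B : ℝ) (F : ℝ → ℝ → ℝ) (hB : 0 ≤ B)
    (hF : ∀ θ y, Real.arctan b₀ < θ → θ < π / 2 → |F θ y| ≤ B) :
    |(π * (π / 2 - Real.arctan b₀))⁻¹ *
      ∫ θ in (Real.arctan b₀)..(π / 2), ∫ y in (0:ℝ)..(2 * π), F θ y| ≤ 2 * B := by
  have hw : 0 < π / 2 - Real.arctan b₀ := by linarith [Real.arctan_lt_pi_div_two b₀]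
  have hpi := Real.pi_pos
  have h1 : ‖∫ θ in (Real.arctan b₀)..(π / 2), ∫ y in (0:ℝ)..(2 * π), F θ y‖ ≤
      (B * (2 * π)) * |π / 2 - Real.arctan b₀| := by
    apply intervalIntegral.norm_integral_le_of_norm_le_const_ae
    have hne : ∀ᵐ θ : ℝ, θ ≠ π / 2 := by simp [ae_iff]
    filter_upwards [hne] with θ hθ1 hθ
    rw [uIoc_of_le (by linarith)] at hθ
    have := intervalIntegral.norm_integral_le_of_norm_le_const (a := 0) (b := 2 * π) (C := B)
      (f := F θ) (fun y _ => hF θ y hθ.1 (lt_of_le_of_ne hθ.2 hθ1))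
    rwa [sub_zero, abs_of_pos (by positivity)] at this
  rw [abs_of_pos hw, Real.norm_eq_abs] at h1
  generalize π / 2 - Real.arctan b₀ = W at *
  rw [abs_mul, abs_of_pos (by positivity)]
  calc _ ≤ (π * W)⁻¹ * (B * (2 * π) * W) := by gcongr
    _ = _ := by field_simp

/-- Lemma A.2: the series `I₂ = Σ_{n≥1}(R^{(1)}_{0n}(r) sin(ny₂) + R^{(2)}_{0n}(r) cos(ny₂))`
converges absolutely and is bounded by `C‖f‖^{(1−δ,2−δ₀)}_{1,α;Q}`, `C` independent of `L`, `f`. -/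
theorem stmt18 (b₀ α δ δ₀ : ℝ) (hb₀ : 0 < b₀) (hα0 : 0 < α) (hα1 : α < 1)
    (hδ0 : 0 < δ) (hδ1 : δ < 1) (hδ₀0 : 0 < δ₀) (hδ₀1 : δ₀ < 1) :
    ∃ C : ℝ, 0 < C ∧
      ∀ L : ℝ, 4 ≤ L →
      ∀ (f : V3 → ℝ) (Mf : ℝ), 0 ≤ Mf →
        ContDiffOn ℝ 1 f (SQ b₀) →
        wnormLE (SQ b₀) 1 α (1 - δ) (2 - δ₀) (wedgeQ b₀) f Mf →
        Per2On (closure (wedgeQ b₀)) f →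
        (∀ r : ℝ, 0 < r → r ≤ L →
            Summable fun n : ℕ =>
              |R0n L (f0n1 b₀ f (n + 1)) (n + 1) r| +
              |R0n L (f0n2 b₀ f (n + 1)) (n + 1) r|) ∧
        (∀ r y₂ : ℝ, 0 < r → r ≤ L →
            |∑' n : ℕ,
                (R0n L (f0n1 b₀ f (n + 1)) (n + 1) r * Real.sin ((n + 1) * y₂) +
                 R0n L (f0n2 b₀ f (n + 1)) (n + 1) r * Real.cos ((n + 1) * y₂))| ≤
              C * Mf) := by
  set d := min δ (1/2) with hdd
  have hd0 : 0 < d := lt_min hδ0 (by norm_num)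
  have hd : d ≤ 1/2 := min_le_right _ _
  have hdδ : d ≤ δ := min_le_left _ _
  have hGpos : 0 < Real.Gamma (d + 1/2) := Real.Gamma_pos_of_pos (by linarith)
  set c := 66 + 2 * Real.Gamma (d + 1/2) with hc
  have hsum : Summable fun n : ℕ => ((n + 1 : ℕ):ℝ) ^ (-1 - d) :=
    (summable_nat_add_iff 1).2 (Real.summable_nat_rpow.2 (by linarith))
  set S := ∑' n : ℕ, ((n + 1 : ℕ):ℝ) ^ (-1 - d) with hS
  have hS0 : 0 ≤ S := tsum_nonneg fun n => by positivity
  refine ⟨4 * c * S + 1, by positivity, ?_⟩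
  intro L hL f M hM _ hf _
  have hg1 : ∀ n : ℕ, ∀ s, 0 < s → s ≠ 1 → |f0n1 b₀ f n s| ≤ 2 * M * s ^ (d - 1) := by
    intro n s hs hs1
    unfold f0n1
    rw [mul_assoc]
    apply coef_bound _ _ _ (by positivity)
    intro θ y h0 h1
    have := f_bound b₀ α δ δ₀ d M hb₀ hδ1 hδ₀1 hd0 hdδ f hM hf s θ y hs hs1 h0 h1
    rw [abs_mul]
    calc _ ≤ |fPolar f s θ y| * 1 := by gcongr; exact Real.abs_sin_le_one _
      _ ≤ _ := by linarith
  have hg2 : ∀ n : ℕ, ∀ s, 0 < s → s ≠ 1 → |f0n2 b₀ f n s| ≤ 2 * M * s ^ (d - 1) := by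
    intro n s hs hs1
    unfold f0n2
    rw [mul_assoc]
    apply coef_bound _ _ _ (by positivity)
    intro θ y h0 h1
    have := f_bound b₀ α δ δ₀ d M hb₀ hδ1 hδ₀1 hd0 hdδ f hM hf s θ y hs hs1 h0 h1
    rw [abs_mul]
    calc _ ≤ |fPolar f s θ y| * 1 := by gcongr; exact Real.abs_cos_le_one _
      _ ≤ _ := by linarith
  have hR : ∀ r, 0 < r → r ≤ L → ∀ n : ℕ,
      |R0n L (f0n1 b₀ f (n + 1)) (n + 1) r| + |R0n L (f0n2 b₀ f (n + 1)) (n + 1) r| ≤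
        4 * c * M * ((n + 1 : ℕ):ℝ) ^ (-1 - d) := by
    intro r hr hrL n
    have a1 := R_bound L r d (2 * M) (n + 1) _ (by omega) hr hrL hL hd0 hd (by positivity)
      (hg1 (n + 1))
    have a2 := R_bound L r d (2 * M) (n + 1) _ (by omega) hr hrL hL hd0 hd (by positivity)
      (hg2 (n + 1))
    rw [← hc] at a1 a2
    linarith
  refine ⟨fun r hr hrL => ?_, fun r y hr hrL => ?_⟩
  · exact Summable.of_nonneg_of_le (fun n => by positivity) (hR r hr hrL) (hsum.mul_left _)
  · have hb : HasSum (fun n : ℕ => 4 * c * M * ((n + 1 : ℕ):ℝ) ^ (-1 - d)) (4 * c * M * S) :=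
      hsum.hasSum.mul_left _
    have := tsum_of_norm_bounded hb (f := fun n : ℕ =>
      (R0n L (f0n1 b₀ f (n + 1)) (n + 1) r * Real.sin ((n + 1) * y) +
                 R0n L (f0n2 b₀ f (n + 1)) (n + 1) r * Real.cos ((n + 1) * y))) (by
      intro n
      refine le_trans ?_ (hR r hr hrL n)
      refine (norm_add_le _ _).trans (add_le_add ?_ ?_)
      · rw [norm_mul]
        exact mul_le_of_le_one_right (norm_nonneg _) (Real.abs_sin_le_one _)
      · rw [norm_mul]
        exact mul_le_of_le_one_right (norm_nonneg _) (Real.abs_cos_le_one _))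
    rw [Real.norm_eq_abs] at this
    refine this.trans ?_
    nlinarith
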